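/- arXiv:1307.5016 — 2 statements merged into one kernel-verified Lean document; each statement's English description precedes it below -/
import Mathlib

section
/- (Horoballs are nonempty and convex.) Let C ⊆ ℝ^d be a proper open convex cone and let φ be a dual lightcone point for C. Then for every t > 0 the lifted horoball X(φ, t) = {x ∈ C : f_C(x) ≤ 1 and ⟪φ, x⟫ ≤ t} is nonempty and convex. -/
open MeasureTheory Set
open scoped RealInnerProductSpace ENNReal

/-- A proper open convex cone in Euclidean space: a nonempty open convex set,
closed under positive scalar multiplication, whose closure contains no line. -/
structure IsProperOpenConvexCone {d : ℕ} (C : Set (EuclideanSpace ℝ (Fin d))) : Prop where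
  nonempty : C.Nonempty
  isOpen : IsOpen C
  convex : Convex ℝ C
  smul_mem : ∀ t : ℝ, 0 < t → ∀ x ∈ C, t • x ∈ C
  salient : closure C ∩ (-closure C) = {0}

/-- The dual cone of `C`: functionals (identified with vectors via the inner
product) that are nonnegative on the closure of `C`. -/
def dualConeSet {d : ℕ} (C : Set (EuclideanSpace ℝ (Fin d))) : Set (EuclideanSpace ℝ (Fin d)) :=
  {φ | ∀ x ∈ closure C, 0 ≤ ⟪φ, x⟫}

/-- The characteristic function of the cone `C`. -/
noncomputable def charFn {d : ℕ} (C : Set (EuclideanSpace ℝ (Fin d)))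
    (x : EuclideanSpace ℝ (Fin d)) : ℝ≥0∞ :=
  ∫⁻ φ in dualConeSet C, ENNReal.ofReal (Real.exp (-⟪φ, x⟫))

lemma isClosed_dualConeSet {d : ℕ} (C : Set (EuclideanSpace ℝ (Fin d))) :
    IsClosed (dualConeSet C) := by
  have : dualConeSet C = ⋂ x ∈ closure C, {φ : EuclideanSpace ℝ (Fin d) | 0 ≤ ⟪φ, x⟫} := by
    ext φ; simp [dualConeSet]
  rw [this]
  exact isClosed_biInter fun x _ => isClosed_le continuous_const (by fun_prop)

lemma measurable_integrand {d : ℕ} (x : EuclideanSpace ℝ (Fin d)) :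
    Measurable fun φ : EuclideanSpace ℝ (Fin d) => ENNReal.ofReal (Real.exp (-⟪φ, x⟫)) := by
  apply ENNReal.measurable_ofReal.comp
  exact Continuous.measurable (by fun_prop)

lemma charFn_convex {d : ℕ} (C : Set (EuclideanSpace ℝ (Fin d)))
    (x y : EuclideanSpace ℝ (Fin d)) (a b : ℝ) (ha : 0 ≤ a) (hb : 0 ≤ b) (hab : a + b = 1) :
    charFn C (a • x + b • y) ≤
      ENNReal.ofReal a * charFn C x + ENNReal.ofReal b * charFn C y := by
  unfold charFn
  rw [← lintegral_const_mul _ (measurable_integrand x),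
    ← lintegral_const_mul _ (measurable_integrand y),
    ← lintegral_add_left ((measurable_integrand x).const_mul _)]
  apply lintegral_mono
  intro φ
  simp only
  rw [← ENNReal.ofReal_mul ha, ← ENNReal.ofReal_mul hb,
    ← ENNReal.ofReal_add (by positivity) (by positivity)]
  apply ENNReal.ofReal_le_ofReal
  have h := convexOn_exp.2 (mem_univ (-⟪φ, x⟫)) (mem_univ (-⟪φ, y⟫)) ha hb hab
  simp only [smul_eq_mul] at h
  rw [inner_add_right, inner_smul_right, inner_smul_right]
  have he : -(a * ⟪φ, x⟫ + b * ⟪φ, y⟫) = a * -⟪φ, x⟫ + b * -⟪φ, y⟫ := by linarith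
  rw [he]
  exact h

lemma integrable_exp_neg_mul_norm {d : ℕ} (hd : 0 < d) (r : ℝ) (hr : 0 < r) :
    Integrable fun φ : EuclideanSpace ℝ (Fin d) => Real.exp (-r * ‖φ‖) := by
  have : Nonempty (Fin d) := ⟨⟨0, hd⟩⟩
  have : Nontrivial (EuclideanSpace ℝ (Fin d)) := inferInstance
  rw [integrable_fun_norm_addHaar volume (f := fun y : ℝ => Real.exp (-r * y))]
  have h := integrableOn_rpow_mul_exp_neg_mul_rpow (p := 1) (s := ((d - 1 : ℕ) : ℝ)) (b := r)
    (by have : (0 : ℝ) ≤ ((d - 1 : ℕ) : ℝ) := Nat.cast_nonneg _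
        linarith) one_pos hr
  simpa [Real.rpow_natCast] using h

lemma charFn_ne_top {d : ℕ} (hd : 0 < d) (C : Set (EuclideanSpace ℝ (Fin d)))
    (hC : IsOpen C) (x : EuclideanSpace ℝ (Fin d)) (hx : x ∈ C) : charFn C x ≠ ∞ := by
  obtain ⟨r, hr, hball⟩ := Metric.nhds_basis_closedBall.mem_iff.1 (hC.mem_nhds hx)
  have hI := (integrable_exp_neg_mul_norm hd r hr).lintegral_lt_top
  refine ne_of_lt (lt_of_le_of_lt ?_ hI)
  unfold charFn
  refine le_trans ?_ (setLIntegral_le_lintegral (dualConeSet C) _)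
  apply setLIntegral_mono' (isClosed_dualConeSet C).measurableSet
  intro φ hφ
  apply ENNReal.ofReal_le_ofReal
  apply Real.exp_le_exp.2
  rcases eq_or_ne φ 0 with h0 | h0
  · simp [h0]
  have hn : ‖φ‖ ≠ 0 := norm_ne_zero_iff.2 h0
  have hm : x - (r / ‖φ‖) • φ ∈ C := by
    apply hball
    rw [Metric.mem_closedBall, dist_eq_norm, sub_sub_cancel_left, norm_neg, norm_smul,
      Real.norm_eq_abs, abs_of_nonneg (by positivity), div_mul_cancel₀ _ hn]
  have h := hφ _ (subset_closure hm)
  rw [inner_sub_right, inner_smul_right, real_inner_self_eq_norm_sq] at h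
  have h2 : r / ‖φ‖ * ‖φ‖ ^ 2 = r * ‖φ‖ := by field_simp
  linarith

lemma add_smul_mem_cone {d : ℕ} (C : Set (EuclideanSpace ℝ (Fin d)))
    (hC : IsProperOpenConvexCone C) (x v : EuclideanSpace ℝ (Fin d)) (hx : x ∈ C)
    (hv : v ∈ closure C) (s : ℝ) (hs : 0 ≤ s) : x + s • v ∈ C := by
  have h1 : 0 < 1 + s := by linarith
  have h := hC.convex.combo_interior_closure_mem_interior (a := 1 / (1 + s)) (b := s / (1 + s))
    (by rwa [hC.isOpen.interior_eq]) hv (by positivity) (by positivity) (by field_simp)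
  have h2 := hC.smul_mem (1 + s) h1 _ (interior_subset h)
  rw [smul_add, smul_smul, smul_smul, mul_div_cancel₀ _ h1.ne', mul_div_cancel₀ _ h1.ne',
    one_smul] at h2
  exact h2

lemma tendsto_charFn {d : ℕ} (hd : 0 < d) (C : Set (EuclideanSpace ℝ (Fin d)))
    (hC : IsOpen C) (x v : EuclideanSpace ℝ (Fin d)) (hx : x ∈ C)
    (hv : v ∈ closure C) (hv0 : v ≠ 0) :
    Filter.Tendsto (fun n : ℕ => charFn C (x + (n : ℝ) • v)) Filter.atTop (nhds 0) := by
  have hms := (isClosed_dualConeSet C).measurableSet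
  have key := tendsto_lintegral_of_dominated_convergence
    (μ := volume.restrict (dualConeSet C))
    (F := fun (n : ℕ) φ => ENNReal.ofReal (Real.exp (-⟪φ, x + (n : ℝ) • v⟫)))
    (f := fun _ => 0)
    (fun φ => ENNReal.ofReal (Real.exp (-⟪φ, x⟫)))
    (fun n => measurable_integrand _) ?_ (charFn_ne_top hd C hC x hx) ?_
  · simpa [charFn] using key
  · intro n
    refine ae_restrict_of_forall_mem hms ?_
    intro φ hφ
    apply ENNReal.ofReal_le_ofReal
    apply Real.exp_le_exp.2
    rw [inner_add_right, inner_smul_right]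
    have := mul_nonneg (Nat.cast_nonneg (α := ℝ) n) (hφ v hv)
    linarith
  · have hnull : ∀ᵐ φ : EuclideanSpace ℝ (Fin d), φ ∉ (ℝ ∙ v)ᗮ := by
      have := Measure.addHaar_submodule (volume : Measure (EuclideanSpace ℝ (Fin d))) (ℝ ∙ v)ᗮ
        (by
          intro h
          have hm : v ∈ (ℝ ∙ v)ᗮ := by rw [h]; trivial
          rw [Submodule.mem_orthogonal_singleton_iff_inner_left] at hm
          exact hv0 (inner_self_eq_zero.1 hm))
      exact measure_eq_zero_iff_ae_notMem.1 this
    filter_upwards [ae_restrict_mem hms, ae_restrict_of_ae hnull] with φ hφ hne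
    rw [Submodule.mem_orthogonal_singleton_iff_inner_left] at hne
    have hpos : 0 < ⟪φ, v⟫ := lt_of_le_of_ne (hφ v hv) (Ne.symm hne)
    rw [← ENNReal.ofReal_zero]
    apply ENNReal.tendsto_ofReal
    apply Real.tendsto_exp_neg_atTop_nhds_zero.comp
    simp only [inner_add_right, inner_smul_right]
    exact Filter.tendsto_atTop_add_const_left _ _
      (tendsto_natCast_atTop_atTop.atTop_mul_const hpos)

/-- Horoballs are nonempty and convex. -/
theorem horoball_nonempty_convex {d : ℕ} (hd : 0 < d)
    (C : Set (EuclideanSpace ℝ (Fin d))) (hC : IsProperOpenConvexCone C)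
    (φ : EuclideanSpace ℝ (Fin d)) (hφ0 : φ ≠ 0)
    (hφK : ∀ x ∈ closure C, 0 ≤ ⟪φ, x⟫)
    (hφL : ∃ v ∈ frontier C \ {0}, ⟪φ, v⟫ = 0)
    (t : ℝ) (ht : 0 < t) :
    {x | x ∈ C ∧ charFn C x ≤ 1 ∧ ⟪φ, x⟫ ≤ t}.Nonempty ∧
    Convex ℝ {x | x ∈ C ∧ charFn C x ≤ 1 ∧ ⟪φ, x⟫ ≤ t} := by
  constructor
  · obtain ⟨v, ⟨hvf, hv0⟩, hφv⟩ := hφL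
    have hv : v ∈ closure C := frontier_subset_closure hvf
    have hv0' : v ≠ 0 := by simpa using hv0
    obtain ⟨x, hx⟩ := hC.nonempty
    have hpx := hφK x (subset_closure hx)
    have hs : 0 < t / (⟪φ, x⟫ + 1) := by positivity
    have hx0 := hC.smul_mem _ hs x hx
    have hlim := tendsto_charFn hd C hC.isOpen _ v hx0 hv hv0'
    obtain ⟨n, hn⟩ := (hlim.eventually (gt_mem_nhds one_pos)).exists
    refine ⟨_, add_smul_mem_cone C hC _ v hx0 hv n (Nat.cast_nonneg n), hn.le, ?_⟩
    rw [inner_add_right, inner_smul_right, inner_smul_right, hφv, mul_zero, add_zero,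
      div_mul_eq_mul_div, div_le_iff₀ (by linarith)]
    nlinarith
  · rintro x ⟨hxC, hx1, hxt⟩ y ⟨hyC, hy1, hyt⟩ a b ha hb hab
    refine ⟨hC.convex hxC hyC ha hb hab, ?_, ?_⟩
    · refine (charFn_convex C x y a b ha hb hab).trans ?_
      calc _ ≤ ENNReal.ofReal a * 1 + ENNReal.ofReal b * 1 := by gcongr
        _ = 1 := by
          rw [mul_one, mul_one, ← ENNReal.ofReal_add ha hb, hab, ENNReal.ofReal_one]
    · rw [inner_add_right, inner_smul_right, inner_smul_right]
      calc _ ≤ a * t + b * t := by gcongr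
        _ = t := by rw [← add_mul, hab, one_mul]
end

section
/- (Epstein–Penner discreteness, dual formulation.) Let C ⊆ ℝ^d be a proper open convex cone, let Γ be a group of linear automorphisms of ℝ^d such that every γ ∈ Γ satisfies |det γ| = 1 and γ(C) = C, and let φ be a dual lightcone point for C. Assume there exists t > 0 such that the lifted horoball X(φ, t) is precisely invariant: for every γ ∈ Γ, if γ(X(φ, t)) ∩ X(φ, t) ≠ ∅ then ⟪φ, γ x⟫ = ⟪φ, x⟫ for all x ∈ ℝ^d. Then the dual orbit {φ ∘ γ⁻¹ : γ ∈ Γ} = {(γ⁻¹)ᵀ φ : γ ∈ Γ} is a closed discrete subset of ℝ^d (it has no accumulation point in ℝ^d). -/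
open MeasureTheory Set
open scoped RealInnerProductSpace ENNReal

open Filter Topology

lemma ep_measurable_dual {d : ℕ} (C : Set (EuclideanSpace ℝ (Fin d))) :
    MeasurableSet (dualConeSet C) := by
  have : dualConeSet C = ⋂ x ∈ closure C, {φ | 0 ≤ ⟪φ, x⟫} := by
    ext φ; simp [dualConeSet]
  rw [this]
  apply IsClosed.measurableSet
  apply isClosed_biInter
  intro x _
  exact isClosed_le continuous_const (by fun_prop)

lemma ep_det_adjoint {d : ℕ}
    (f : EuclideanSpace ℝ (Fin d) →ₗ[ℝ] EuclideanSpace ℝ (Fin d)) :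
    LinearMap.det (LinearMap.adjoint f) = LinearMap.det f := by
  let b := EuclideanSpace.basisFun (Fin d) ℝ
  rw [← LinearMap.det_toMatrix b.toBasis, ← LinearMap.det_toMatrix b.toBasis,
    LinearMap.toMatrix_adjoint b b, Matrix.det_conjTranspose]
  simp

lemma ep_closure_image {d : ℕ} (C : Set (EuclideanSpace ℝ (Fin d)))
    (γ : EuclideanSpace ℝ (Fin d) ≃ₗ[ℝ] EuclideanSpace ℝ (Fin d)) (h : γ '' C = C) :
    γ '' closure C = closure C := by
  have := γ.toContinuousLinearEquiv.image_closure C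
  simpa [h] using this

lemma ep_charFn_inv {d : ℕ} (C : Set (EuclideanSpace ℝ (Fin d)))
    (γ : EuclideanSpace ℝ (Fin d) ≃ₗ[ℝ] EuclideanSpace ℝ (Fin d)) (h : γ '' C = C)
    (hdet : |LinearMap.det γ.toLinearMap| = 1) (x : EuclideanSpace ℝ (Fin d)) :
    charFn C (γ x) = charFn C x := by
  set A := LinearMap.adjoint γ.toLinearMap with hA
  have hdA : |LinearMap.det A| = 1 := by rw [hA, ep_det_adjoint, hdet]
  have hA0 : LinearMap.det A ≠ 0 := by
    intro h0; rw [h0] at hdA; simp at hdA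
  have hAc : Continuous A := A.continuous_of_finiteDimensional
  have hmp : MeasurePreserving A volume volume := by
    refine ⟨hAc.measurable, ?_⟩
    rw [Measure.map_linearMap_addHaar_eq_smul_addHaar _ hA0, abs_inv, hdA]
    simp
  have hpre : A ⁻¹' dualConeSet C = dualConeSet C := by
    have hcl := ep_closure_image C γ h
    ext ψ
    simp only [dualConeSet, mem_preimage, mem_ofPred_eq, hA, LinearMap.adjoint_inner_left]
    constructor
    · intro H y hy
      rw [← hcl] at hy
      obtain ⟨w, hw, rfl⟩ := hy
      exact H w hw
    · intro H y hy
      apply H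
      rw [← hcl]
      exact ⟨y, hy, rfl⟩
  unfold charFn
  symm
  rw [← hmp.setLIntegral_comp_preimage (ep_measurable_dual C) (by fun_prop), hpre]
  simp only [hA, LinearMap.adjoint_inner_left]
  rfl

lemma ep_add_mem {d : ℕ} {C : Set (EuclideanSpace ℝ (Fin d))} (hC : IsProperOpenConvexCone C)
    {x v : EuclideanSpace ℝ (Fin d)} (hx : x ∈ C) (hv : v ∈ closure C) : x + v ∈ C := by
  have h := hC.convex.combo_interior_closure_mem_interior
    (by rwa [hC.isOpen.interior_eq]) hv (a := 1/2) (b := 1/2) (by norm_num) (by norm_num)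
    (by norm_num) (x := x)
  rw [hC.isOpen.interior_eq] at h
  have := hC.smul_mem 2 (by norm_num) _ h
  simpa [smul_smul] using this

lemma ep_smul_closure {d : ℕ} {C : Set (EuclideanSpace ℝ (Fin d))}
    (hC : IsProperOpenConvexCone C)
    {v : EuclideanSpace ℝ (Fin d)} (hv : v ∈ closure C) {a : ℝ} (ha : 0 < a) :
    a • v ∈ closure C := by
  refine map_mem_closure (f := fun w => a • w) (by fun_prop) hv ?_
  intro w hw
  exact hC.smul_mem a ha w hw

lemma ep_lower {d : ℕ} {C : Set (EuclideanSpace ℝ (Fin d))} (hC : IsProperOpenConvexCone C)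
    {x : EuclideanSpace ℝ (Fin d)} (hx : x ∈ C) :
    ∃ c : ℝ, 0 < c ∧ ∀ ψ ∈ dualConeSet C, c * ‖ψ‖ ≤ ⟪ψ, x⟫ := by
  obtain ⟨r, hr, hb⟩ := Metric.isOpen_iff.1 hC.isOpen x hx
  refine ⟨r / 2, by positivity, ?_⟩
  intro ψ hψ
  by_cases h0 : ψ = 0
  · simp [h0]
  have hn : 0 < ‖ψ‖ := norm_pos_iff.2 h0
  have hm : x - (r / 2 / ‖ψ‖) • ψ ∈ C := by
    apply hb
    rw [Metric.mem_ball, dist_eq_norm, sub_sub_cancel_left, norm_neg, norm_smul, Real.norm_eq_abs,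
      abs_of_pos (by positivity), div_mul_cancel₀ _ hn.ne']
    linarith
  have := hψ _ (subset_closure hm)
  rw [inner_sub_right, inner_smul_right, real_inner_self_eq_norm_sq] at this
  have e : r / 2 / ‖ψ‖ * ‖ψ‖ ^ 2 = r / 2 * ‖ψ‖ := by field_simp
  linarith

lemma ep_integrable {d : ℕ} {c : ℝ} (hc : 0 < c) :
    Integrable (fun ψ : EuclideanSpace ℝ (Fin d) => Real.exp (-(c * ‖ψ‖))) := by
  have h1 := integrable_one_add_norm (E := EuclideanSpace ℝ (Fin d)) (μ := volume)
    (r := ((d + 1 : ℕ) : ℝ)) (by simp)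
  refine (h1.const_mul (Real.exp c * (Nat.factorial (d + 1)) / c ^ (d + 1))).mono' ?_ ?_
  · exact Continuous.aestronglyMeasurable (by fun_prop)
  · refine Eventually.of_forall fun ψ => ?_
    rw [Real.norm_eq_abs, abs_of_pos (Real.exp_pos _), Real.rpow_neg (by positivity),
      Real.rpow_natCast]
    have hp : 0 < 1 + ‖ψ‖ := by positivity
    have h2 := Real.pow_div_factorial_le_exp (x := c * (1 + ‖ψ‖)) (by positivity) (d + 1)
    have h3 : Real.exp (-(c * ‖ψ‖)) = Real.exp c / Real.exp (c * (1 + ‖ψ‖)) := by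
      rw [← Real.exp_sub]; congr 1; ring
    rw [h3]
    have hf : (0 : ℝ) < Nat.factorial (d + 1) := by positivity
    calc _ ≤ Real.exp c / ((c * (1 + ‖ψ‖)) ^ (d + 1) / Nat.factorial (d + 1)) := by gcongr
      _ = _ := by rw [mul_pow]; field_simp

lemma ep_finite {d : ℕ} {C : Set (EuclideanSpace ℝ (Fin d))} (hC : IsProperOpenConvexCone C)
    {x : EuclideanSpace ℝ (Fin d)} (hx : x ∈ C) : charFn C x ≠ ∞ := by
  obtain ⟨c, hc, h⟩ := ep_lower hC hx
  have hfin := (ep_integrable (d := d) hc).lintegral_lt_top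
  refine (lt_of_le_of_lt ?_ hfin).ne
  refine le_trans ?_ (setLIntegral_le_lintegral (dualConeSet C) _)
  refine setLIntegral_mono' (ep_measurable_dual C) fun ψ hψ => ?_
  apply ENNReal.ofReal_le_ofReal
  apply Real.exp_le_exp.2
  linarith [h ψ hψ]

lemma ep_tendsto {d : ℕ} {C : Set (EuclideanSpace ℝ (Fin d))} (hC : IsProperOpenConvexCone C)
    {x v : EuclideanSpace ℝ (Fin d)} (hx : x ∈ C) (hv : v ∈ closure C) (hv0 : v ≠ 0) :
    Tendsto (fun n : ℕ => charFn C (x + (n : ℝ) • v)) atTop (𝓝 0) := by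
  have key := tendsto_lintegral_of_dominated_convergence
    (μ := volume.restrict (dualConeSet C))
    (F := fun (n : ℕ) ψ => ENNReal.ofReal (Real.exp (-⟪ψ, x + (n : ℝ) • v⟫))) (f := fun _ => 0)
    (fun ψ => ENNReal.ofReal (Real.exp (-⟪ψ, x⟫))) (by intro n; fun_prop) ?_
    (ep_finite hC hx) ?_
  · simpa [charFn] using key
  · intro n
    refine (ae_restrict_iff' (ep_measurable_dual C)).2 (Eventually.of_forall fun ψ hψ => ?_)
    apply ENNReal.ofReal_le_ofReal
    apply Real.exp_le_exp.2
    rw [inner_add_right, inner_smul_right]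
    have := mul_nonneg (Nat.cast_nonneg (α := ℝ) n) (hψ v hv)
    linarith
  · refine (ae_restrict_iff' (ep_measurable_dual C)).2 ?_
    have hnull : volume ((ℝ ∙ v)ᗮ : Set (EuclideanSpace ℝ (Fin d))) = 0 := by
      apply Measure.addHaar_submodule
      intro htop
      have : v ∈ (ℝ ∙ v)ᗮ := by rw [htop]; trivial
      rw [Submodule.mem_orthogonal_singleton_iff_inner_right] at this
      exact hv0 (inner_self_eq_zero.1 this)
    have hae : ∀ᵐ ψ : EuclideanSpace ℝ (Fin d), ψ ∉ ((ℝ ∙ v)ᗮ : Set _) :=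
      measure_eq_zero_iff_ae_notMem.1 hnull
    filter_upwards [hae] with ψ hψ hd
    have hne : ⟪ψ, v⟫ ≠ 0 := by
      intro h
      exact hψ ((Submodule.mem_orthogonal_singleton_iff_inner_left).2 h)
    have hpos : 0 < ⟪ψ, v⟫ := lt_of_le_of_ne (hd v hv) hne.symm
    rw [← ENNReal.ofReal_zero]
    apply ENNReal.tendsto_ofReal
    apply Real.tendsto_exp_atBot.comp
    apply tendsto_neg_atTop_atBot.comp
    simp only [inner_add_right, inner_smul_right]
    exact tendsto_atTop_add_const_left _ _
      (tendsto_natCast_atTop_atTop.atTop_mul_const hpos)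

lemma ep_limit_zero {d : ℕ} (C S : Set (EuclideanSpace ℝ (Fin d)))
    (hS : ∀ ψ ∈ S, ∃ v ∈ closure C, ‖v‖ = 1 ∧ ⟪ψ, v⟫ = 0)
    {z : EuclideanSpace ℝ (Fin d)} (hz : z ∈ closure S) :
    ∃ v ∈ closure C, ‖v‖ = 1 ∧ ⟪z, v⟫ = 0 := by
  obtain ⟨u, hu, hlim⟩ := mem_closure_iff_seq_limit.1 hz
  choose w hw hn hz using fun n => hS (u n) (hu n)
  have hK : IsCompact (Metric.sphere (0 : EuclideanSpace ℝ (Fin d)) 1 ∩ closure C) :=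
    (isCompact_sphere _ _).inter_right isClosed_closure
  obtain ⟨v, hv, g, hg, hlim2⟩ := hK.tendsto_subseq (x := w) (fun n => ⟨by simp [hn], hw n⟩)
  refine ⟨v, hv.2, by simpa using hv.1, ?_⟩
  have h3 := (hlim.comp hg.tendsto_atTop).inner (𝕜 := ℝ) hlim2
  refine tendsto_nhds_unique h3 ?_
  simp [hz]

/-- Epstein–Penner discreteness, dual formulation: if some lifted horoball of a
dual lightcone point is precisely invariant, then the dual orbit of the point
has no accumulation point in ℝ^d (it is closed and discrete). -/
theorem epstein_penner_dual {d : ℕ} (hd : 0 < d)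
    (C : Set (EuclideanSpace ℝ (Fin d))) (hC : IsProperOpenConvexCone C)
    (Γ : Subgroup (EuclideanSpace ℝ (Fin d) ≃ₗ[ℝ] EuclideanSpace ℝ (Fin d)))
    (hdet : ∀ γ ∈ Γ, |LinearMap.det γ.toLinearMap| = 1)
    (hΓC : ∀ γ ∈ Γ, γ '' C = C)
    (φ : EuclideanSpace ℝ (Fin d)) (hφ0 : φ ≠ 0)
    (hφK : ∀ x ∈ closure C, 0 ≤ ⟪φ, x⟫)
    (hφL : ∃ v ∈ frontier C \ {0}, ⟪φ, v⟫ = 0)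
    (t : ℝ) (ht : 0 < t)
    (hprec : ∀ γ ∈ Γ,
      (γ '' {x | x ∈ C ∧ charFn C x ≤ 1 ∧ ⟪φ, x⟫ ≤ t} ∩
        {x | x ∈ C ∧ charFn C x ≤ 1 ∧ ⟪φ, x⟫ ≤ t}).Nonempty →
      ∀ x, ⟪φ, γ x⟫ = ⟪φ, x⟫) :
    ∀ z : EuclideanSpace ℝ (Fin d),
      ¬ AccPt z (Filter.principal
        {ψ | ∃ γ ∈ Γ, ψ = LinearMap.adjoint (γ⁻¹ : EuclideanSpace ℝ (Fin d) ≃ₗ[ℝ]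
          EuclideanSpace ℝ (Fin d)).toLinearMap φ}) := by
  intro z hacc
  set S := {ψ | ∃ γ ∈ Γ, ψ = LinearMap.adjoint (γ⁻¹ : EuclideanSpace ℝ (Fin d) ≃ₗ[ℝ]
          EuclideanSpace ℝ (Fin d)).toLinearMap φ} with hSdef
  obtain ⟨v₀, ⟨hv₀f, hv₀0⟩, hv₀φ⟩ := hφL
  have hv₀0' : v₀ ≠ 0 := hv₀0
  have hS : ∀ ψ ∈ S, ∃ v ∈ closure C, ‖v‖ = 1 ∧ ⟪ψ, v⟫ = 0 := by
    rintro ψ ⟨γ, hγ, rfl⟩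
    have hmem : γ v₀ ∈ closure C := by
      rw [← ep_closure_image C γ (hΓC γ hγ)]
      exact ⟨v₀, frontier_subset_closure hv₀f, rfl⟩
    have hne : γ v₀ ≠ 0 := by simpa using hv₀0'
    have hp : 0 < ‖γ v₀‖ := norm_pos_iff.2 hne
    refine ⟨‖γ v₀‖⁻¹ • γ v₀, ep_smul_closure hC hmem (by positivity), ?_, ?_⟩
    · rw [norm_smul, norm_inv, norm_norm, inv_mul_cancel₀ hp.ne']
    · rw [LinearMap.adjoint_inner_left, map_smul, inner_smul_right]
      have : (γ⁻¹ : EuclideanSpace ℝ (Fin d) ≃ₗ[ℝ] EuclideanSpace ℝ (Fin d)).toLinearMap (γ v₀)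
          = v₀ := γ.symm_apply_apply v₀
      rw [this, hv₀φ, mul_zero]
  have hacc' := accPt_iff_frequently.1 hacc
  have hzcl : z ∈ closure S := mem_closure_iff_frequently.2 (hacc'.mono fun _ h => h.2)
  obtain ⟨v, hvC, hvn, hzv⟩ := ep_limit_zero C S hS hzcl
  have hv0 : v ≠ 0 := by
    intro h; simp [h] at hvn
  obtain ⟨x, hx⟩ := hC.nonempty
  -- a point of `C` far along `v` and close to the lightcone
  obtain ⟨ε, hε, hεt⟩ : ∃ ε : ℝ, 0 < ε ∧ ε * ⟪z, x⟫ < t := by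
    refine ⟨t / (2 * (|⟪z, x⟫| + 1)), by positivity, ?_⟩
    rw [div_mul_eq_mul_div, div_lt_iff₀ (by positivity)]
    have := le_abs_self ⟪z, x⟫
    have := abs_nonneg ⟪z, x⟫
    nlinarith
  have hεx := hC.smul_mem ε hε x hx
  have hev := (ep_tendsto hC hεx hvC hv0).eventually (gt_mem_nhds (zero_lt_one (α := ℝ≥0∞)))
  obtain ⟨n, hn1, hn⟩ := (hev.and (eventually_gt_atTop 0)).exists
  set y := ε • x + (n : ℝ) • v with hy
  have hyC : y ∈ C := ep_add_mem hC hεx (ep_smul_closure hC hvC (by exact_mod_cast hn))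
  have hzy : ⟪z, y⟫ < t := by
    rw [hy, inner_add_right, inner_smul_right, inner_smul_right, hzv]
    simpa using hεt
  have hnear : ∀ᶠ ψ in 𝓝 z, ⟪ψ, y⟫ < t :=
    (Continuous.continuousAt (f := fun ψ : EuclideanSpace ℝ (Fin d) => ⟪ψ, y⟫)
      (by fun_prop)).eventually (gt_mem_nhds hzy)
  obtain ⟨ψ₁, ⟨hψ₁z, hψ₁S⟩, hψ₁y⟩ := (hacc'.and_eventually hnear).exists
  obtain ⟨ψ₂, ⟨⟨_, hψ₂S⟩, hψ₂y⟩, hψ₂ne⟩ :=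
    ((hacc'.and_eventually hnear).and_eventually (isOpen_ne.mem_nhds hψ₁z.symm)).exists
  apply hψ₂ne
  obtain ⟨γ₁, hγ₁, rfl⟩ := hψ₁S
  obtain ⟨γ₂, hγ₂, rfl⟩ := hψ₂S
  have hX : ∀ γ ∈ Γ, ⟪LinearMap.adjoint (γ⁻¹ : EuclideanSpace ℝ (Fin d) ≃ₗ[ℝ]
          EuclideanSpace ℝ (Fin d)).toLinearMap φ, y⟫ < t →
      γ⁻¹ y ∈ {x | x ∈ C ∧ charFn C x ≤ 1 ∧ ⟪φ, x⟫ ≤ t} := by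
    intro γ hγ hlt
    have hi := Γ.inv_mem hγ
    refine ⟨?_, ?_, ?_⟩
    · rw [← hΓC _ hi]; exact ⟨y, hyC, rfl⟩
    · rw [ep_charFn_inv C _ (hΓC _ hi) (hdet _ hi)]; exact hn1.le
    · rw [LinearMap.adjoint_inner_left] at hlt; exact hlt.le
  have hinv := hprec (γ₂⁻¹ * γ₁) (Γ.mul_mem (Γ.inv_mem hγ₂) hγ₁)
    ⟨γ₂⁻¹ y, ⟨γ₁⁻¹ y, hX γ₁ hγ₁ hψ₁y, by
      rw [← LinearEquiv.mul_apply, mul_assoc, mul_inv_cancel, mul_one]⟩, hX γ₂ hγ₂ hψ₂y⟩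
  refine ext_inner_right ℝ fun w => ?_
  rw [LinearMap.adjoint_inner_left, LinearMap.adjoint_inner_left]
  have h := hinv (γ₁⁻¹ w)
  rw [← LinearEquiv.mul_apply, mul_assoc, mul_inv_cancel, mul_one] at h
  exact h
end
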